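/- arXiv:2004.00684 — 2 statements merged into one kernel-verified Lean document; each statement's English description precedes it below -/
import Mathlib

section
/- For all integers n ≥ 0 and k ≥ 1, the number of lattice paths of length 2n+1 that stay in the strip [-k-1, k] and end at height -1 is equal to the number of lattice paths of length 2n+1 that stay in the strip [0, 2k+1] (with no restriction on the final height). -/
/-- The height of a lattice path `s : Fin n → ℤ` after `j` steps:
the sum of the first `j` steps. -/
def pathHeight {n : ℕ} (s : Fin n → ℤ) (j : ℕ) : ℤ :=
  ∑ i ∈ Finset.univ.filter (fun i : Fin n => (i : ℕ) < j), s i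

/-- The number of lattice paths of length `n` (steps `±1`) whose height stays in
`[a, b]` at every time `0 ≤ j ≤ n` and whose final height lies in `E`. -/
noncomputable def pathCount (n : ℕ) (a b : ℤ) (E : Set ℤ) : ℕ :=
  Nat.card {s : Fin n → ℤ //
    (∀ i, s i ∈ ({1, -1} : Set ℤ)) ∧
    (∀ j ≤ n, pathHeight s j ∈ Set.Icc a b) ∧
    pathHeight s n ∈ E}

theorem pathHeight_zero {n : ℕ} (s : Fin n → ℤ) : pathHeight s 0 = 0 := by
  simp [pathHeight]

theorem pathHeight_cons_succ {n : ℕ} (e : ℤ) (s : Fin n → ℤ) (j : ℕ) :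
    pathHeight (Fin.cons e s : Fin (n + 1) → ℤ) (j + 1) = e + pathHeight s j := by
  simp [pathHeight, Finset.sum_filter, Fin.sum_univ_succ]

/-- The set of lattice paths counted by `pathCount`. -/
def pathSet (n : ℕ) (a b : ℤ) (E : Set ℤ) : Set (Fin n → ℤ) :=
  {s | (∀ i, s i ∈ ({1, -1} : Set ℤ)) ∧
    (∀ j ≤ n, pathHeight s j ∈ Set.Icc a b) ∧
    pathHeight s n ∈ E}

theorem pathCount_eq_ncard (n : ℕ) (a b : ℤ) (E : Set ℤ) :
    pathCount n a b E = (pathSet n a b E).ncard := rfl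

theorem pathSet_finite (n : ℕ) (a b : ℤ) (E : Set ℤ) : (pathSet n a b E).Finite :=
  (Set.Finite.pi' (t := fun _ : Fin n => ({1, -1} : Set ℤ)) fun _ => by simp).subset
    fun _ hs => hs.1

theorem pathCount_zero (a b : ℤ) (E : Set ℤ) [Decidable (0 ∈ E)] :
    pathCount 0 a b E = if (a ≤ 0 ∧ 0 ≤ b) ∧ 0 ∈ E then 1 else 0 := by
  rw [pathCount_eq_ncard]
  split_ifs with h
  · have : pathSet 0 a b E = Set.univ := by
      ext s
      simp [pathSet, pathHeight_zero, h]
    simp [this, Set.ncard_univ]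
  · have : pathSet 0 a b E = ∅ := by
      ext s
      simpa [pathSet, pathHeight_zero] using h
    simp [this]

theorem pathCount_eq_zero_of_notMem {n : ℕ} {a b : ℤ} (E : Set ℤ) (h : ¬ (a ≤ 0 ∧ 0 ≤ b)) :
    pathCount n a b E = 0 := by
  have : pathSet n a b E = ∅ := by
    refine Set.eq_empty_of_forall_notMem fun s hs => h ?_
    simpa [pathHeight_zero] using hs.2.1 0 (Nat.zero_le n)
  rw [pathCount_eq_ncard, this, Set.ncard_empty]

theorem cons_mem_pathSet_iff {n : ℕ} {a b : ℤ} {E : Set ℤ} (h : a ≤ 0 ∧ 0 ≤ b)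
    (e : ℤ) (s : Fin n → ℤ) :
    (Fin.cons e s : Fin (n + 1) → ℤ) ∈ pathSet (n + 1) a b E ↔
      e ∈ ({1, -1} : Set ℤ) ∧ s ∈ pathSet n (a - e) (b - e) {y | e + y ∈ E} := by
  have hstrip : (∀ j ≤ n + 1, pathHeight (Fin.cons e s : Fin (n + 1) → ℤ) j ∈ Set.Icc a b) ↔
      ∀ j ≤ n, pathHeight s j ∈ Set.Icc (a - e) (b - e) := by
    constructor
    · intro H j hj
      have := H (j + 1) (by omega)
      rw [pathHeight_cons_succ, Set.mem_Icc] at this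
      rw [Set.mem_Icc]
      omega
    · rintro H (_ | j) hj
      · simpa [pathHeight_zero] using h
      · have := H j (by omega)
        rw [pathHeight_cons_succ, Set.mem_Icc]
        rw [Set.mem_Icc] at this
        omega
  simp only [pathSet, Set.mem_ofPred_eq, hstrip, pathHeight_cons_succ, Fin.forall_fin_succ,
    Fin.cons_zero, Fin.cons_succ, and_assoc]

theorem pathCount_succ {n : ℕ} {a b : ℤ} (E : Set ℤ) (h : a ≤ 0 ∧ 0 ≤ b) :
    pathCount (n + 1) a b E =
      pathCount n (a + 1) (b + 1) {y | -1 + y ∈ E} +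
        pathCount n (a - 1) (b - 1) {y | 1 + y ∈ E} := by
  have hset : pathSet (n + 1) a b E =
      (Fin.cons (α := fun _ => ℤ) (-1)) ''
          pathSet n (a + 1) (b + 1) {y | -1 + y ∈ E} ∪
        (Fin.cons (α := fun _ => ℤ) 1) ''
          pathSet n (a - 1) (b - 1) {y | 1 + y ∈ E} := by
    ext t
    obtain ⟨e, s, rfl⟩ : ∃ (e : ℤ) (s : Fin n → ℤ), t = Fin.cons e s :=
      ⟨t 0, Fin.tail t, (Fin.cons_self_tail t).symm⟩
    rw [cons_mem_pathSet_iff h]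
    simp only [Set.mem_union, Set.mem_image, Fin.cons_inj, Set.mem_insert_iff,
      Set.mem_singleton_iff]
    constructor
    · rintro ⟨rfl | rfl, hs⟩
      · exact Or.inr ⟨s, hs, rfl, rfl⟩
      · exact Or.inl ⟨s, by simpa only [sub_neg_eq_add] using hs, rfl, rfl⟩
    · rintro (⟨s, hs, rfl, rfl⟩ | ⟨s, hs, rfl, rfl⟩)
      · exact ⟨Or.inr rfl, by simpa only [sub_neg_eq_add] using hs⟩
      · exact ⟨Or.inl rfl, hs⟩
  simp only [pathCount_eq_ncard]
  rw [hset, Set.ncard_union_eq ?_ ((pathSet_finite ..).image _) ((pathSet_finite ..).image _),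
    Set.ncard_image_of_injective _ (Fin.cons_right_injective _),
    Set.ncard_image_of_injective _ (Fin.cons_right_injective _)]
  rw [Set.disjoint_left]
  rintro _ ⟨s, -, rfl⟩ ⟨t, -, ht⟩
  have := congrFun ht 0
  simp at this

/-- The number of walks of a given length from `x` to `y` with steps `±1` inside `[0, M]`. -/
def stripWalks (M : ℤ) : ℕ → ℤ → ℤ → ℤ
  | 0, x, y => if x = y ∧ 0 ≤ x ∧ x ≤ M then 1 else 0
  | N + 1, x, y =>
    if 0 ≤ x ∧ x ≤ M then stripWalks M N (x - 1) y + stripWalks M N (x + 1) y else 0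

namespace stripWalks

variable {M : ℤ}

theorem eq_zero_left (N : ℕ) {x : ℤ} (y : ℤ) (hx : ¬ (0 ≤ x ∧ x ≤ M)) :
    stripWalks M N x y = 0 := by
  cases N <;> simp [stripWalks, hx]

theorem succ_right (N : ℕ) (x y : ℤ) :
    stripWalks M (N + 1) x y =
      if 0 ≤ y ∧ y ≤ M then stripWalks M N x (y - 1) + stripWalks M N x (y + 1) else 0 := by
  induction N generalizing x with
  | zero =>
    simp only [stripWalks]
    split_ifs <;> omega
  | succ N ih =>
    rw [stripWalks, ih, ih, stripWalks, stripWalks]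
    split_ifs <;> ring

theorem symm (N : ℕ) (x y : ℤ) : stripWalks M N x y = stripWalks M N y x := by
  induction N generalizing x y with
  | zero =>
    simp only [stripWalks]
    split_ifs <;> omega
  | succ N ih => rw [stripWalks, succ_right, ih, ih (x + 1)]

theorem eq_zero_of_odd (N : ℕ) (x y : ℤ) (h : (N + x + y) % 2 = 1) :
    stripWalks M N x y = 0 := by
  induction N generalizing x with
  | zero =>
    rw [stripWalks, if_neg]
    push_cast at h
    omega
  | succ N ih =>
    push_cast at h
    rw [stripWalks, ih _ (by omega), ih _ (by omega)]
    simp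

/-- The discrete wave equation. -/
theorem wave (N : ℕ) {x y : ℤ} (hx : 0 ≤ x ∧ x ≤ M) (hy : 0 ≤ y ∧ y ≤ M) :
    stripWalks M N (x - 1) y + stripWalks M N (x + 1) y =
      stripWalks M N x (y - 1) + stripWalks M N x (y + 1) := by
  have h := succ_right (M := M) N x y
  rwa [stripWalks, if_pos hx, if_pos hy] at h

theorem eq_sum (N a : ℕ) (b : ℤ) (hab : a ≤ b) (hM : a + b ≤ M) :
    stripWalks M N a b = ∑ i ∈ Finset.range (a + 1), stripWalks M N 0 (b - a + 2 * i) := by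
  induction a using Nat.twoStepInduction generalizing b with
  | zero => simp
  | one =>
    have h := wave (M := M) N (x := 0) (y := b) (by omega) (by omega)
    rw [eq_zero_left N b (x := 0 - 1) (by omega)] at h
    simp only [Finset.sum_range_succ, Finset.sum_range_zero]
    push_cast
    ring_nf at h ⊢
    linarith
  | more a ih₁ ih₂ =>
    push_cast at *
    have h := wave (M := M) N (x := a + 1) (y := b) (by omega) (by omega)
    rw [ih₂ (b - 1) (by omega) (by omega), ih₂ (b + 1) (by omega) (by omega),
      add_sub_cancel_right, ih₁ b (by omega) (by omega)] at h
    rw [Finset.sum_range_succ _ (a + 2)]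
    have e₁ : ∀ i : ℕ, b - 1 - (a + 1) + 2 * (i : ℤ) = b - (a + 2) + 2 * i := fun i => by ring
    have e₂ : ∀ i : ℕ, b + 1 - (a + 1) + 2 * (i : ℤ) = b - a + 2 * i := fun i => by ring
    have e₃ : b - a + 2 * ((a + 1 : ℕ) : ℤ) = b - (a + 2) + 2 * ((a + 2 : ℕ) : ℤ) := by
      push_cast; ring
    have e₄ : (a : ℤ) + 1 + 1 = a + 2 := by ring
    simp only [e₁, e₂, e₄] at h
    rw [Finset.sum_range_succ (fun i : ℕ => stripWalks M N 0 (b - a + 2 * i)) (a + 1), e₃] at h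
    linarith

end stripWalks

theorem pathCount_singleton (M : ℤ) (N : ℕ) (x y : ℤ) :
    (pathCount N (-x) (M - x) {y - x} : ℤ) = stripWalks M N x y := by
  classical
  induction N generalizing x with
  | zero =>
    rw [pathCount_zero, stripWalks]
    simp only [Set.mem_singleton_iff]
    split_ifs <;> first | rfl | omega
  | succ N ih =>
    by_cases h : 0 ≤ x ∧ x ≤ M
    · rw [pathCount_succ _ (by omega), stripWalks, if_pos h, ← ih, ← ih]
      push_cast
      congr 3
      · ring
      · ring
      · ext z; simp only [Set.mem_ofPred_eq, Set.mem_singleton_iff]; omega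
      · ring
      · ring
      · ext z; simp only [Set.mem_ofPred_eq, Set.mem_singleton_iff]; omega
    · rw [pathCount_eq_zero_of_notMem _ (by omega), stripWalks, if_neg h, Nat.cast_zero]

theorem pathCount_univ (m N : ℕ) (x : ℤ) :
    (pathCount N (-x) (m - x) Set.univ : ℤ) =
      ∑ y ∈ Finset.range (m + 1), stripWalks m N x y := by
  classical
  induction N generalizing x with
  | zero =>
    rw [pathCount_zero]
    simp only [stripWalks]
    by_cases h : 0 ≤ x ∧ x ≤ m
    · lift x to ℕ using h.1
      simp only [h, Nat.cast_inj, Set.mem_univ, and_true, Finset.sum_ite_eq, Finset.mem_range]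
      split_ifs <;> first | rfl | omega
    · rw [if_neg (by simp only [Set.mem_univ]; omega)]
      simp [h]
  | succ N ih =>
    by_cases h : 0 ≤ x ∧ x ≤ m
    · rw [pathCount_succ _ (by omega)]
      simp only [stripWalks, if_pos h, Finset.sum_add_distrib, ← ih]
      push_cast
      congr 3
      · ring
      · ring
      · ring
      · ring
    · rw [pathCount_eq_zero_of_notMem _ (by omega)]
      simp [stripWalks, h]

theorem sum_range_two_mul_of_even_eq_zero {u : ℤ → ℤ} (hu : ∀ i : ℕ, u (2 * i) = 0) (k : ℕ) :
    ∑ y ∈ Finset.range (2 * k), u y = ∑ i ∈ Finset.range k, u (1 + 2 * i) := by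
  induction k with
  | zero => simp
  | succ k ih =>
    rw [mul_add_one, Finset.sum_range_succ, Finset.sum_range_succ, ih, Finset.sum_range_succ]
    push_cast
    rw [hu, add_zero, add_comm (1 : ℤ)]

theorem stmt_4 (n k : ℕ) (hk : 1 ≤ k) :
    pathCount (2 * n + 1) (-(k : ℤ) - 1) (k : ℤ) ({-1} : Set ℤ)
      = pathCount (2 * n + 1) 0 (2 * k + 1 : ℤ) Set.univ := by
  have hl := pathCount_singleton (2 * k + 1) (2 * n + 1) (k + 1) k
  have hr := pathCount_univ (2 * k + 1) (2 * n + 1) 0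
  rw [stripWalks.symm, stripWalks.eq_sum _ _ _ (by omega) (by omega)] at hl
  rw [show 2 * k + 1 + 1 = 2 * (k + 1) by ring, sum_range_two_mul_of_even_eq_zero
    fun i => stripWalks.eq_zero_of_odd _ _ _ (by push_cast; omega)] at hr
  rw [neg_add', show (2 * k + 1 - (k + 1) : ℤ) = k by ring,
    show (k - (k + 1) : ℤ) = -1 by ring, show (k + 1 - k : ℤ) = 1 by ring] at hl
  push_cast at hr
  rw [neg_zero, sub_zero] at hr
  exact_mod_cast hl.trans hr.symm
end

section
/- For every integer n ≥ 0, the number of lattice paths of length 2n+1 that stay in the strip [0, 3] and end at height 3 equals the Fibonacci number F(2n). -/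
/-- The lattice paths of length `n` that stay in the strip `[a, b]` and end at height `m`. -/
def stripPaths (n : ℕ) (a b m : ℤ) : Set (Fin n → ℤ) :=
  {s | (∀ i, s i ∈ ({1, -1} : Set ℤ)) ∧
    (∀ j ≤ n, pathHeight s j ∈ Set.Icc a b) ∧
    pathHeight s n ∈ ({m} : Set ℤ)}

theorem pathCount_singleton_s13 (n : ℕ) (a b m : ℤ) :
    pathCount n a b {m} = (stripPaths n a b m).ncard :=
  Nat.card_coe_set_eq _

theorem stripPaths_finite (n : ℕ) (a b m : ℤ) : (stripPaths n a b m).Finite :=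
  (Set.Finite.pi' fun _ : Fin n => Set.toFinite ({1, -1} : Set ℤ)).subset fun _ hs => hs.1

theorem pathHeight_snoc_of_le {n : ℕ} (s : Fin n → ℤ) (x : ℤ) {j : ℕ} (hj : j ≤ n) :
    pathHeight (Fin.snoc s x : Fin (n + 1) → ℤ) j = pathHeight s j := by
  simp [pathHeight, Finset.sum_filter, Fin.sum_univ_castSucc, hj]

theorem pathHeight_snoc_last {n : ℕ} (s : Fin n → ℤ) (x : ℤ) :
    pathHeight (Fin.snoc s x : Fin (n + 1) → ℤ) (n + 1) = pathHeight s n + x := by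
  simp [pathHeight, Finset.sum_filter, Fin.sum_univ_castSucc]

theorem snoc_mem_stripPaths {n : ℕ} {a b m : ℤ} (hm : m ∈ Set.Icc a b) (s : Fin n → ℤ) (x : ℤ) :
    (Fin.snoc s x : Fin (n + 1) → ℤ) ∈ stripPaths (n + 1) a b m ↔
      x ∈ ({1, -1} : Set ℤ) ∧ s ∈ stripPaths n a b (m - x) := by
  simp only [stripPaths, Set.mem_ofPred_eq, Fin.forall_fin_succ', Fin.snoc_castSucc, Fin.snoc_last,
    pathHeight_snoc_last, Set.mem_singleton_iff]
  constructor
  · rintro ⟨⟨hs, hx⟩, hj, he⟩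
    refine ⟨hx, hs, fun j hjn => ?_, by omega⟩
    rw [← pathHeight_snoc_of_le s x hjn]
    exact hj j (by omega)
  · rintro ⟨hx, hs, hj, he⟩
    refine ⟨⟨hs, hx⟩, fun j hjn => ?_, by omega⟩
    rcases Nat.le_succ_iff.1 hjn with h | rfl
    · rw [pathHeight_snoc_of_le s x h]
      exact hj j h
    · rw [Nat.succ_eq_add_one, pathHeight_snoc_last, he]
      simpa using hm

theorem pathCount_succ_s13 {n : ℕ} {a b m : ℤ} (hm : m ∈ Set.Icc a b) :
    pathCount (n + 1) a b {m} = pathCount n a b {m - 1} + pathCount n a b {m + 1} := by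
  have hinj (x : ℤ) : Function.Injective (fun s : Fin n → ℤ => (Fin.snoc s x : Fin (n + 1) → ℤ)) :=
    fun s t h => (Fin.snoc_inj.1 h).1
  have hunion : stripPaths (n + 1) a b m =
      (fun s : Fin n → ℤ => (Fin.snoc s 1 : Fin (n + 1) → ℤ)) '' stripPaths n a b (m - 1) ∪
      (fun s : Fin n → ℤ => (Fin.snoc s (-1) : Fin (n + 1) → ℤ)) '' stripPaths n a b (m + 1) := by
    ext t
    induction t using Fin.snocCases with
    | snoc s x =>
      rw [snoc_mem_stripPaths hm]
      simp only [Set.mem_union, Set.mem_image, Fin.snoc_inj, Set.mem_insert_iff,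
        Set.mem_singleton_iff]
      constructor
      · rintro ⟨rfl | rfl, hs⟩
        · exact Or.inl ⟨s, hs, rfl, rfl⟩
        · exact Or.inr ⟨s, by simpa using hs, rfl, rfl⟩
      · rintro (⟨s, hs, rfl, rfl⟩ | ⟨s, hs, rfl, rfl⟩)
        · exact ⟨Or.inl rfl, hs⟩
        · exact ⟨Or.inr rfl, by simpa using hs⟩
  simp only [pathCount_singleton_s13]
  rw [hunion, Set.ncard_union_eq _ ((stripPaths_finite _ _ _ _).image _)
    ((stripPaths_finite _ _ _ _).image _), Set.ncard_image_of_injective _ (hinj _),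
    Set.ncard_image_of_injective _ (hinj _)]
  rw [Set.disjoint_left]
  rintro _ ⟨s, -, rfl⟩ ⟨t, -, h⟩
  have := (Fin.snoc_inj.1 h).2
  omega

theorem pathCount_eq_zero {n : ℕ} {a b m : ℤ} (hm : m ∉ Set.Icc a b) :
    pathCount n a b {m} = 0 := by
  rw [pathCount_singleton_s13, Set.ncard_eq_zero (stripPaths_finite _ _ _ _),
    Set.eq_empty_iff_forall_notMem]
  rintro s ⟨-, h, rfl⟩
  exact hm (h n le_rfl)

theorem pathCount_zero_s13 {a b : ℤ} (h : (0 : ℤ) ∈ Set.Icc a b) (m : ℤ) :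
    pathCount 0 a b {m} = if m = 0 then 1 else 0 := by
  rw [pathCount_singleton_s13]
  split_ifs with hm
  · rw [Set.ncard_eq_one]
    refine ⟨Fin.elim0, Set.eq_singleton_iff_unique_mem.2 ⟨?_, fun _ _ => Subsingleton.elim _ _⟩⟩
    simpa [stripPaths, pathHeight, hm] using h
  · rw [Set.ncard_eq_zero (stripPaths_finite _ _ _ _), Set.eq_empty_iff_forall_notMem]
    rintro s ⟨-, -, hs⟩
    exact hm (by simpa [pathHeight, eq_comm] using hs)

theorem pathCount_strip_three_odd (n : ℕ) :
    pathCount (2 * n + 1) 0 3 {1} = Nat.fib (2 * n + 1) ∧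
      pathCount (2 * n + 1) 0 3 {3} = Nat.fib (2 * n) := by
  have h0 (k : ℕ) : pathCount (k + 1) 0 3 {0} = pathCount k 0 3 {1} := by
    rw [pathCount_succ_s13 (by simp), pathCount_eq_zero (by simp)]
    simp
  have h1 (k : ℕ) : pathCount (k + 1) 0 3 {1} = pathCount k 0 3 {0} + pathCount k 0 3 {2} := by
    rw [pathCount_succ_s13 (by simp)]
    norm_num
  have h2 (k : ℕ) : pathCount (k + 1) 0 3 {2} = pathCount k 0 3 {1} + pathCount k 0 3 {3} := by
    rw [pathCount_succ_s13 (by simp)]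
    norm_num
  have h3 (k : ℕ) : pathCount (k + 1) 0 3 {3} = pathCount k 0 3 {2} := by
    rw [pathCount_succ_s13 (by simp), pathCount_eq_zero (m := 3 + 1) (by simp)]
    norm_num
  induction n with
  | zero => simp [h1, h3, pathCount_zero_s13]
  | succ n ih =>
    obtain ⟨ih1, ih3⟩ := ih
    have hf2 : Nat.fib (2 * n + 2) = Nat.fib (2 * n) + Nat.fib (2 * n + 1) := Nat.fib_add_two
    have hf3 : Nat.fib (2 * n + 3) = Nat.fib (2 * n + 1) + Nat.fib (2 * n + 2) := Nat.fib_add_two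
    rw [show 2 * (n + 1) + 1 = 2 * n + 1 + 1 + 1 by ring, h1, h3, h0, h2, ih1, ih3,
      show 2 * n + 1 + 1 + 1 = 2 * n + 3 by ring, show 2 * (n + 1) = 2 * n + 2 by ring]
    omega

theorem stmt_13 (n : ℕ) :
    pathCount (2 * n + 1) 0 3 ({3} : Set ℤ) = Nat.fib (2 * n) :=
  (pathCount_strip_three_odd n).2
end
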